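/- Let m ≥ 1 and let n = 2m or n = 2m+1. There is an isomorphism of abelian groups ℤ × (ℤ/2)^m ≅ GW(𝔽₂[x]/(xⁿ)) sending (1, 0) to [1] and, for each 0 ≤ i < m, the i-th standard generator of (ℤ/2)^m to ⟨⟨1 + x^{2i+1}⟩⟩ = [1] − [1 + x^{2i+1}]. -/

import Mathlib

noncomputable section

/-- The subgroup of squares of units of a commutative ring. -/
def squareUnits (R : Type) [CommRing R] : Subgroup Rˣ :=
  (powMonoidHom 2 : Rˣ →* Rˣ).range

/-- The group of square classes `Rˣ/(Rˣ)²`. -/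
def SqCl (R : Type) [CommRing R] : Type := Rˣ ⧸ squareUnits R

instance (R : Type) [CommRing R] : CommGroup (SqCl R) :=
  QuotientGroup.Quotient.commGroup (squareUnits R)

/-- The square class `[a]` of a unit `a`. -/
def cls {R : Type} [CommRing R] (a : Rˣ) : SqCl R := QuotientGroup.mk a

/-- The group ring `ℤ[Rˣ/(Rˣ)²]`. -/
abbrev GRing (R : Type) [CommRing R] := MonoidAlgebra ℤ (SqCl R)

/-- The generator `[a]` of the group ring, for a unit `a`. -/
def gen {R : Type} [CommRing R] (a : Rˣ) : GRing R :=
  MonoidAlgebra.of ℤ (SqCl R) (cls a)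

/-- The set of relations defining the Grothendieck–Witt ring of a (connected semi-)local ring:
`([a₁]+[a₂]+[a₃]+[a₄]) − ([b₁]+[b₂]+[b₃]+[b₄])` whenever there exists `P ∈ GL₄(R)` with
`P ⬝ diag(a₁,…,a₄) ⬝ Pᵀ = diag(b₁,…,b₄)`. -/
def gwRel (R : Type) [CommRing R] : Set (GRing R) :=
  {x | ∃ (a b : Fin 4 → Rˣ) (P : Matrix (Fin 4) (Fin 4) R),
    IsUnit P.det ∧
    P * Matrix.diagonal (fun i => (a i : R)) * P.transpose =
      Matrix.diagonal (fun i => (b i : R)) ∧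
    x = (∑ i, gen (a i)) - (∑ i, gen (b i))}

/-- The (symmetric) Grothendieck–Witt ring of `R`, presented à la Knebusch–Rosenberg–Ware. -/
abbrev GW (R : Type) [CommRing R] := GRing R ⧸ Ideal.span (gwRel R)

/-- The class `[a] ∈ GW(R)` of a unit `a`. -/
def gw {R : Type} [CommRing R] (a : Rˣ) : GW R :=
  Ideal.Quotient.mk (Ideal.span (gwRel R)) (gen a)

/-- The (symmetric) Witt ring of `R` : the quotient of `GW(R)` by the ideal generated by the
hyperbolic element `[1] + [-1]`. -/
abbrev Wr (R : Type) [CommRing R] := GW R ⧸ Ideal.span {gw (R := R) 1 + gw (-1)}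

/-- The class in the Witt ring of a unit `a`. -/
def wcl {R : Type} [CommRing R] (a : Rˣ) : Wr R :=
  Ideal.Quotient.mk (Ideal.span {gw (R := R) 1 + gw (-1)}) (gw a)

/-- The ring `𝔽₂[x]/(xⁿ)` of truncated polynomials. -/
abbrev Rtrunc (n : ℕ) : Type :=
  Polynomial (ZMod 2) ⧸ Ideal.span {(Polynomial.X : Polynomial (ZMod 2)) ^ n}

/-- The class of `x` in `𝔽₂[x]/(xⁿ)`. -/
def xbar (n : ℕ) : Rtrunc n :=
  Ideal.Quotient.mk (Ideal.span {(Polynomial.X : Polynomial (ZMod 2)) ^ n}) Polynomial.X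


/-! ### The truncated polynomial ring -/

lemma rt_two (n : ℕ) : (2 : Rtrunc n) = 0 := by
  have h : (2 : Polynomial (ZMod 2)) = 0 := CharTwo.two_eq_zero
  have := congrArg (Ideal.Quotient.mk (Ideal.span {(Polynomial.X : Polynomial (ZMod 2)) ^ n})) h
  rw [map_zero] at this
  exact this

lemma rt_xpow (n : ℕ) : xbar n ^ n = 0 := by
  unfold xbar
  rw [← map_pow, Ideal.Quotient.eq_zero_iff_mem]
  exact Ideal.mem_span_singleton_self _

lemma rt_unit {n : ℕ} (r : Rtrunc n) : IsUnit (1 + xbar n * r) := by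
  apply IsNilpotent.isUnit_one_add
  exact ⟨n, by rw [mul_pow, rt_xpow, zero_mul]⟩

lemma rt_cases {n : ℕ} (r : Rtrunc n) :
    (∃ q, r = xbar n * q) ∨ (∃ q, r = 1 + xbar n * q) := by
  obtain ⟨f, rfl⟩ := Ideal.Quotient.mk_surjective r
  have h := Polynomial.X_mul_divX_add f
  have h01 : ∀ c : ZMod 2, c = 0 ∨ c = 1 := by decide
  rcases h01 (f.coeff 0) with h0 | h0
  · left
    refine ⟨Ideal.Quotient.mk _ f.divX, ?_⟩
    unfold xbar
    rw [← map_mul]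
    congr 1
    rw [h0] at h
    simpa using h.symm
  · right
    refine ⟨Ideal.Quotient.mk _ f.divX, ?_⟩
    unfold xbar
    rw [← map_mul, ← map_one (Ideal.Quotient.mk _), ← map_add]
    congr 1
    rw [h0] at h
    rw [add_comm]
    simpa using h.symm

lemma rt_not_unit {n : ℕ} (hn : 1 ≤ n) (r : Rtrunc n) : ¬ IsUnit (xbar n * r) := by
  have hnil : IsNilpotent (xbar n * r) := ⟨n, by rw [mul_pow, rt_xpow, zero_mul]⟩
  have : Nontrivial (Rtrunc n) := by
    apply Ideal.Quotient.nontrivial_iff.mpr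
    rw [Ne, Ideal.span_singleton_eq_top, isUnit_pow_iff (by omega)]
    exact Polynomial.not_isUnit_X
  exact fun h => hnil.not_isUnit h

/-- Every element is a square plus `x` times a square. -/
lemma poly_decomp (f : Polynomial (ZMod 2)) :
    ∃ g h : Polynomial (ZMod 2), f = g ^ 2 + Polynomial.X * h ^ 2 := by
  induction f using Polynomial.induction_on' with
  | add p q hp hq =>
    obtain ⟨g, h, rfl⟩ := hp
    obtain ⟨g', h', rfl⟩ := hq
    exact ⟨g + g', h + h', by rw [CharTwo.add_sq, CharTwo.add_sq]; ring⟩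
  | monomial k c =>
    have hc : ∀ c : ZMod 2, c = c ^ 2 := by decide
    rw [← Polynomial.C_mul_X_pow_eq_monomial, hc c, Polynomial.C_pow]
    rcases Nat.even_or_odd' k with ⟨j, rfl | rfl⟩
    · exact ⟨Polynomial.C c * Polynomial.X ^ j, 0, by ring⟩
    · exact ⟨0, Polynomial.C c * Polynomial.X ^ j, by ring⟩

lemma rt_decomp {n : ℕ} (r : Rtrunc n) : ∃ g h : Rtrunc n, r = g ^ 2 + xbar n * h ^ 2 := by
  obtain ⟨f, rfl⟩ := Ideal.Quotient.mk_surjective r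
  obtain ⟨g, h, rfl⟩ := poly_decomp f
  exact ⟨Ideal.Quotient.mk _ g, Ideal.Quotient.mk _ h, by simp [xbar]⟩

/-! ### Relations in `GW` -/

section general
variable {R : Type} [CommRing R]

lemma gen_mul (a b : Rˣ) : gen (a * b) = gen a * gen b := by
  unfold gen
  rw [← map_mul]; rfl

lemma gen_one : gen (1 : Rˣ) = 1 := by
  unfold gen
  exact map_one _

lemma gw_mul (a b : Rˣ) : gw (a * b) = gw a * gw b := by
  unfold gw
  rw [gen_mul, map_mul]

lemma gw_one : gw (1 : Rˣ) = 1 := by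
  unfold gw
  rw [gen_one, map_one]

lemma gw_rel_two (u b : Rˣ) (s t : R) (h : s ^ 2 + u * t ^ 2 = b) :
    gw 1 + gw u = gw b + gw (u * b) := by
  have hm : gen (1 : Rˣ) + gen u - (gen b + gen (u * b)) ∈ gwRel R := by
    refine ⟨![1, u, 1, 1], ![b, u * b, 1, 1],
      !![s, t, 0, 0; -(u * t), s, 0, 0; 0, 0, 1, 0; 0, 0, 0, 1], ?_, ?_, ?_⟩
    · have : (!![s, t, 0, 0; -(u * t), s, 0, 0; 0, 0, 1, 0; 0, 0, 0, 1] :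
          Matrix (Fin 4) (Fin 4) R).det = b := by
        rw [← h]
        simp [Matrix.det_succ_row_zero, Fin.sum_univ_succ, Fin.succAbove]
        ring
      rw [this]; exact b.isUnit
    · ext i j
      rw [Matrix.mul_apply, Fin.sum_univ_four, Matrix.diagonal_apply]
      simp only [Matrix.mul_diagonal, Matrix.transpose_apply]
      fin_cases i <;> fin_cases j <;> simp [← h] <;> try ring1
    · simp [Fin.sum_univ_four]
  have := Ideal.Quotient.eq_zero_iff_mem.mpr (Ideal.subset_span hm)
  rw [map_sub, map_add, map_add, sub_eq_zero] at this
  exact this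

lemma gw_rel_four (h2 : (2 : R) = 0) (u b : Rˣ) (s t : R) (h : s ^ 2 + u * t ^ 2 = 1 + b) :
    gw (1 : Rˣ) + gw 1 = gw b + gw b := by
  have hm : gen (1 : Rˣ) + gen 1 + (gen 1 + gen u) - (gen b + gen b + (gen 1 + gen u))
      ∈ gwRel R := by
    have hmat : (!![1, 0, s, t; 1 + (b : R), (b : R), s, t; s, s, 1, 0; u * t, u * t, 0, 1] :
          Matrix (Fin 4) (Fin 4) R) *
        Matrix.diagonal (fun i => ((![1, 1, 1, u] i : Rˣ) : R)) *
        (!![1, 0, s, t; 1 + (b : R), (b : R), s, t; s, s, 1, 0; u * t, u * t, 0, 1] :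
          Matrix (Fin 4) (Fin 4) R).transpose =
        Matrix.diagonal (fun i => ((![b, b, 1, u] i : Rˣ) : R)) := by
      ext i j
      rw [Matrix.mul_apply, Fin.sum_univ_four, Matrix.diagonal_apply]
      simp only [Matrix.mul_diagonal, Matrix.transpose_apply]
      fin_cases i <;> fin_cases j <;> simp
      · linear_combination h + h2
      · linear_combination h + (1 + b : R) * h2
      · linear_combination s * h2
      · linear_combination (u * t) * h2
      · linear_combination h + (1 + b : R) * h2
      · linear_combination h + (1 + b + b ^ 2 : R) * h2
      · linear_combination (s + b * s) * h2
      · linear_combination (u * t + b * u * t) * h2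
      · linear_combination s * h2
      · linear_combination (s + b * s) * h2
      · linear_combination s ^ 2 * h2
      · linear_combination (s * u * t) * h2
      · linear_combination (u * t) * h2
      · linear_combination (u * t + b * u * t) * h2
      · linear_combination (s * u * t) * h2
      · linear_combination (u ^ 2 * t ^ 2) * h2
    refine ⟨![1, 1, 1, u], ![b, b, 1, u], _, ?_, hmat, ?_⟩
    · have hdet := congrArg Matrix.det hmat
      rw [Matrix.det_mul, Matrix.det_mul, mul_assoc, Matrix.det_diagonal (d := fun i =>
        ((![b, b, 1, u] i : Rˣ) : R)), ← Units.coe_prod] at hdet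
      exact isUnit_of_mul_isUnit_left (hdet ▸ Units.isUnit _)
    · simp [Fin.sum_univ_four]
  have := Ideal.Quotient.eq_zero_iff_mem.mpr (Ideal.subset_span hm)
  simp only [map_sub, map_add] at this
  change gw (1 : Rˣ) + gw 1 + (gw 1 + gw u) - (gw b + gw b + (gw 1 + gw u)) = 0 at this
  linear_combination this

end general

lemma rt_rep {n : ℕ} (u b : Rtrunc n) (u0 : Rtrunc n) (u1 : (Rtrunc n)ˣ)
    (hu : (u : Rtrunc n) = u0 ^ 2 + xbar n * u1 ^ 2) : ∃ s t, s ^ 2 + u * t ^ 2 = b := by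
  obtain ⟨f, g, hb⟩ := rt_decomp b
  have h2 := rt_two n
  have hv : (u1 : Rtrunc n) * (u1⁻¹ : (Rtrunc n)ˣ) = 1 := u1.mul_inv
  generalize ((u1⁻¹ : (Rtrunc n)ˣ) : Rtrunc n) = v at hv
  refine ⟨f + g * u0 * v, g * v, ?_⟩
  rw [hb, hu]
  linear_combination (f * g * u0 * v + g ^ 2 * u0 ^ 2 * v ^ 2) * h2
    + xbar n * g ^ 2 * (u1 * v + 1) * hv

lemma gw_two {n : ℕ} (b : (Rtrunc n)ˣ) : 2 * (1 - gw b) = 0 := by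
  obtain ⟨c, hc⟩ := rt_unit (n := n) 1
  obtain ⟨s, t, h⟩ := rt_rep (c : Rtrunc n) (1 + b) 1 1 (by rw [hc]; simp)
  have := gw_rel_four (rt_two n) c b s t h
  rw [gw_one] at this
  linear_combination this

lemma gw_good {n : ℕ} (u b : (Rtrunc n)ˣ) (u0 : Rtrunc n) (u1 : (Rtrunc n)ˣ)
    (hu : (u : Rtrunc n) = u0 ^ 2 + xbar n * u1 ^ 2) : (1 - gw u) * (1 - gw b) = 0 := by
  obtain ⟨s, t, h⟩ := rt_rep (u : Rtrunc n) b u0 u1 hu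
  have key := gw_rel_two u b s t h
  rw [gw_mul, gw_one] at key
  linear_combination gw_two b - key

lemma gw_all {n : ℕ} (hn : 1 ≤ n) (a b : (Rtrunc n)ˣ) : (1 - gw a) * (1 - gw b) = 0 := by
  have h2 := rt_two n
  obtain ⟨a0, a1, ha⟩ := rt_decomp (a : Rtrunc n)
  rcases rt_cases a1 with ⟨q, hq⟩ | ⟨q, hq⟩
  · rcases rt_cases a0 with ⟨p, hp⟩ | ⟨p, hp⟩
    · exfalso
      apply rt_not_unit hn (xbar n * p ^ 2 + xbar n ^ 2 * q ^ 2)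
      have := a.isUnit
      rw [ha, hp, hq] at this
      convert this using 1
      ring
    · obtain ⟨c, hc⟩ := rt_unit (n := n) 1
      obtain ⟨w, hw⟩ := rt_unit (p + q)
      have h1 := gw_good c b 1 1 (by rw [hc]; simp)
      have h3 := gw_good (a * c) b (a0 + xbar n * a1) w (by
        rw [Units.val_mul, hc, hw, ha, hp, hq]
        linear_combination (-(1 + xbar n * p) * (xbar n * (xbar n * q))
          - xbar n * (1 + xbar n * p) * (xbar n * q)) * h2)
      rw [gw_mul] at h3
      linear_combination h3 - gw a * h1
  · obtain ⟨w, hw⟩ := rt_unit q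
    exact gw_good a b a0 w (by rw [hw, ha, hq])

lemma gw_add {n : ℕ} (hn : 1 ≤ n) (a b : (Rtrunc n)ˣ) : gw a + gw b = 1 + gw (a * b) := by
  rw [gw_mul]
  linear_combination -gw_all hn a b

/-! ### Rank and discriminant -/

section disc
variable {R : Type} [CommRing R]

/-- rank and discriminant on the group ring -/
def rd0 (R : Type) [CommRing R] : GRing R →+ ℤ × Additive (SqCl R) :=
  (Finsupp.liftAddHom (fun g : SqCl R => zmultiplesHom _ ((1 : ℤ), Additive.ofMul g))).comp
    (MonoidAlgebra.coeffAddEquiv : GRing R ≃+ _).toAddMonoidHom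

lemma rd0_gen (a : Rˣ) : rd0 R (gen a) = (1, Additive.ofMul (cls a)) := by
  simp [rd0, gen]

lemma cls_surj (g : SqCl R) : ∃ a : Rˣ, cls a = g := QuotientGroup.mk_surjective g

lemma cls_mul (a b : Rˣ) : cls (a * b) = cls a * cls b := rfl

lemma cls_eq_one {a : Rˣ} : cls a = 1 ↔ ∃ s : Rˣ, s ^ 2 = a := by
  have : cls a = 1 ↔ a ∈ squareUnits R := QuotientGroup.eq_one_iff a
  rw [this]; rfl

lemma rd0_rel (x : GRing R) (hx : x ∈ gwRel R) : rd0 R x = 0 := by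
  obtain ⟨a, b, P, hP, h, rfl⟩ := hx
  obtain ⟨d, hd⟩ := hP
  have hdet := congrArg Matrix.det h
  rw [Matrix.det_mul, Matrix.det_mul, Matrix.det_transpose, Matrix.det_diagonal,
    Matrix.det_diagonal, ← hd] at hdet
  have hu : d ^ 2 * ∏ i, a i = ∏ i, b i := by
    ext
    push_cast
    rw [← hdet]; ring
  have hc : cls (∏ i, a i) = cls (∏ i, b i) := by
    rw [← hu, cls_mul, cls_eq_one.mpr ⟨d, rfl⟩, one_mul]
  rw [map_sub, map_sum, map_sum, sub_eq_zero]
  simp only [rd0_gen, Fin.sum_univ_four, Fin.prod_univ_four, cls_mul] at hc ⊢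
  ext
  · rfl
  · exact hc

lemma rel_gen_mul (c : Rˣ) (x : GRing R) (hx : x ∈ gwRel R) : gen c * x ∈ gwRel R := by
  obtain ⟨a, b, P, hP, h, rfl⟩ := hx
  refine ⟨fun i => c * a i, fun i => c * b i, P, hP, ?_, ?_⟩
  · have e : ∀ f : Fin 4 → Rˣ, Matrix.diagonal (fun i => ((c * f i : Rˣ) : R))
        = (c : R) • Matrix.diagonal (fun i => (f i : R)) := by
      intro f
      rw [← Matrix.diagonal_smul]
      rfl
    rw [e, e, Matrix.mul_smul, Matrix.smul_mul, h]
  · simp only [gen_mul, mul_sub, Finset.mul_sum]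

lemma gring_ind {M : Type*} [AddCommGroup M] (f g : GRing R →+ M)
    (h : ∀ a : Rˣ, f (gen a) = g (gen a)) : f = g := by
  have key : ∀ (c : SqCl R) (k : ℤ), f (MonoidAlgebra.single c k) =
      g (MonoidAlgebra.single c k) := by
    intro c k
    obtain ⟨a, rfl⟩ := cls_surj c
    have : (MonoidAlgebra.single (cls a) k : GRing R) = k • gen a := by
      simp [gen]
    rw [this, map_zsmul, map_zsmul, h]
  exact MonoidAlgebra.addMonoidHom_ext key

lemma rd0_span (x : GRing R) (hx : x ∈ Ideal.span (gwRel R)) : rd0 R x = 0 := by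
  suffices H : ∀ y : GRing R, rd0 R (y * x) = 0 by simpa using H 1
  induction hx using Submodule.span_induction with
  | mem x hx =>
    intro y
    have := gring_ind ((rd0 R).comp (AddMonoidHom.mulRight x)) 0 (fun a => by
      simpa using rd0_rel _ (rel_gen_mul a x hx))
    simpa using DFunLike.congr_fun this y
  | zero => simp
  | add a b _ _ ha hb => intro y; rw [mul_add, map_add, ha, hb, add_zero]
  | smul a b _ hb => intro y; rw [smul_eq_mul, ← mul_assoc]; exact hb _

/-- rank and discriminant -/
def rd (R : Type) [CommRing R] : GW R →+ ℤ × Additive (SqCl R) :=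
  QuotientAddGroup.lift (Ideal.span (gwRel R)).toAddSubgroup (rd0 R) rd0_span

lemma rd_gw (a : Rˣ) : rd R (gw a) = (1, Additive.ofMul (cls a)) := rd0_gen a

lemma gw_ind {M : Type*} [AddCommGroup M] (f g : GW R →+ M)
    (h : ∀ a : Rˣ, f (gw a) = g (gw a)) : f = g := by
  have := gring_ind (f.comp (Ideal.Quotient.mk (Ideal.span (gwRel R))).toAddMonoidHom)
    (g.comp (Ideal.Quotient.mk (Ideal.span (gwRel R))).toAddMonoidHom) h
  ext x
  obtain ⟨y, rfl⟩ := Ideal.Quotient.mk_surjective x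
  exact DFunLike.congr_fun this y

lemma gw_cls {a b : Rˣ} (h : cls a = cls b) : gw a = gw b := by
  unfold gw gen; rw [h]

lemma sq_two (g : Additive (SqCl R)) : 2 • g = 0 := by
  obtain ⟨a, ha⟩ := cls_surj g.toMul
  have : g = Additive.ofMul (cls a) := by rw [ha]; rfl
  rw [this, ← ofMul_pow]
  have h : cls a ^ 2 = 1 := cls_eq_one.mpr ⟨a, rfl⟩
  rw [h]; rfl

instance : Module (ZMod 2) (Additive (SqCl R)) := AddCommGroup.zmodModule sq_two

end disc

/-- the map `[a] ↦ 1 - [a]` -/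
def tau {n : ℕ} (hn : 1 ≤ n) : Additive (SqCl (Rtrunc n)) →+ GW (Rtrunc n) :=
  AddMonoidHom.mk' (fun g => 1 - gw (cls_surj g.toMul).choose) (by
    intro g h
    have e := gw_add hn (cls_surj g.toMul).choose (cls_surj h.toMul).choose
    rw [gw_cls (a := (cls_surj g.toMul).choose * (cls_surj h.toMul).choose)
      (b := (cls_surj (g + h).toMul).choose)] at e
    · linear_combination e
    · rw [cls_mul, (cls_surj g.toMul).choose_spec, (cls_surj h.toMul).choose_spec,
        (cls_surj (g + h).toMul).choose_spec]
      rfl)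

lemma tau_cls {n : ℕ} (hn : 1 ≤ n) (a : (Rtrunc n)ˣ) :
    tau hn (Additive.ofMul (cls a)) = 1 - gw a := by
  unfold tau
  simp only [AddMonoidHom.mk'_apply]
  rw [gw_cls (cls_surj (Additive.ofMul (cls a)).toMul).choose_spec]

/-- The isomorphism with rank and discriminant. -/
def gwEquiv {n : ℕ} (hn : 1 ≤ n) : ℤ × Additive (SqCl (Rtrunc n)) ≃+ GW (Rtrunc n) :=
  AddMonoidHom.toAddEquiv
    (AddMonoidHom.coprod (zmultiplesHom _ (1 : GW (Rtrunc n))) (tau hn)) (rd (Rtrunc n))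
    (by
      refine AddMonoidHom.ext fun ⟨k, g⟩ => ?_
      obtain ⟨a, ha⟩ := cls_surj g.toMul
      obtain rfl : g = Additive.ofMul (cls a) := by rw [ha]; rfl
      have h2 := sq_two (Additive.ofMul (cls a))
      rw [two_nsmul] at h2
      have h1 : rd (Rtrunc n) 1 = (1, 0) := by
        rw [← gw_one, rd_gw]; rfl
      simp only [AddMonoidHom.comp_apply, AddMonoidHom.coprod_apply, zmultiplesHom_apply,
        tau_cls, map_add, map_zsmul, map_sub, rd_gw, h1, AddMonoidHom.id_apply]
      ext
      · simp
      · have h3 := neg_eq_of_add_eq_zero_left h2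
        simp only [Prod.snd_add, Prod.snd_sub, Prod.smul_snd, smul_zero, zero_add, zero_sub]
        exact h3)
    (by
      refine gw_ind _ _ fun a => ?_
      have h := gw_add hn a a
      rw [gw_cls (b := 1) (cls_eq_one.mpr ⟨a, sq a⟩), gw_one] at h
      simp only [AddMonoidHom.comp_apply, AddMonoidHom.coprod_apply, zmultiplesHom_apply,
        tau_cls, rd_gw, AddMonoidHom.id_apply, one_zsmul]
      linear_combination -h)

/-! ### Square classes -/

/-- The unit `1 + x^(2i+1)`. -/
def bu (n i : ℕ) : (Rtrunc n)ˣ :=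
  (show IsUnit (1 + xbar n ^ (2 * i + 1)) by rw [pow_succ']; exact rt_unit _).unit

lemma bu_val (n i : ℕ) : (bu n i : Rtrunc n) = 1 + xbar n ^ (2 * i + 1) := rfl

/-- The linear map given by the classes of `1 + x^(2i+1)`. -/
def kap (m n : ℕ) : (Fin m → ZMod 2) →ₗ[ZMod 2] Additive (SqCl (Rtrunc n)) :=
  Fintype.linearCombination (ZMod 2) (fun i : Fin m => Additive.ofMul (cls (bu n i)))

lemma kap_single (m n : ℕ) (i : Fin m) :
    kap m n (Pi.single i 1) = Additive.ofMul (cls (bu n i)) := by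
  simp [kap, Fintype.linearCombination_apply_single]

lemma kap_surj_aux (m n : ℕ) (hn : n ≤ 2 * m + 1) (d : ℕ) : ∀ j, 1 ≤ j → n ≤ j + d →
    ∀ (a : (Rtrunc n)ˣ) (r : Rtrunc n), (a : Rtrunc n) = 1 + xbar n ^ j * r →
    Additive.ofMul (cls a) ∈ LinearMap.range (kap m n) := by
  have h2 := rt_two n
  have triv : ∀ j, n ≤ j → ∀ (a : (Rtrunc n)ˣ) (r : Rtrunc n),
      (a : Rtrunc n) = 1 + xbar n ^ j * r →
      Additive.ofMul (cls a) ∈ LinearMap.range (kap m n) := by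
    intro j hj a r ha
    obtain ⟨k, rfl⟩ := Nat.exists_eq_add_of_le hj
    rw [pow_add, rt_xpow, zero_mul, zero_mul, add_zero, Units.val_eq_one] at ha
    subst ha
    exact Submodule.zero_mem _
  induction d with
  | zero => exact fun j _ hj => triv j hj
  | succ d ih =>
    intro j hj hd a r ha
    by_cases hjn : n ≤ j
    · exact triv j hjn a r ha
    rcases rt_cases r with ⟨q, hq⟩ | ⟨q, hq⟩
    · exact ih (j + 1) (by omega) (by omega) a q (by rw [ha, hq]; ring)
    · obtain ⟨c, hc, hcm⟩ : ∃ c : (Rtrunc n)ˣ, (c : Rtrunc n) = 1 + xbar n ^ j ∧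
          Additive.ofMul (cls c) ∈ LinearMap.range (kap m n) := by
        rcases Nat.even_or_odd' j with ⟨i, rfl | rfl⟩
        · obtain ⟨i, rfl⟩ : ∃ k, i = k + 1 := ⟨i - 1, by omega⟩
          obtain ⟨s, hs⟩ := rt_unit (xbar n ^ i)
          refine ⟨s ^ 2, ?_, ?_⟩
          · rw [Units.val_pow_eq_pow_val, hs]
            linear_combination (xbar n * xbar n ^ i) * h2
          · rw [cls_eq_one.mpr ⟨s, rfl⟩]
            exact Submodule.zero_mem _
        · exact ⟨bu n i, rfl, ⟨_, kap_single m n ⟨i, by omega⟩⟩⟩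
      obtain ⟨k, rfl⟩ : ∃ k, j = k + 1 := ⟨j - 1, by omega⟩
      have := ih (k + 1 + 1) (by omega) (by omega) (a * c)
        (q + xbar n ^ k * r) (by
          rw [Units.val_mul, ha, hc, hq]
          linear_combination (xbar n ^ (k+1)) * h2)
      rw [cls_mul, ofMul_mul] at this
      exact (Submodule.add_mem_iff_left _ hcm).mp this

lemma kap_surj (m n : ℕ) (hn : n ≤ 2 * m + 1) (hn1 : 1 ≤ n) :
    Function.Surjective (kap m n) := by
  intro g
  obtain ⟨a, ha⟩ := cls_surj g.toMul
  obtain rfl : g = Additive.ofMul (cls a) := by rw [ha]; rfl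
  rcases rt_cases (a : Rtrunc n) with ⟨q, hq⟩ | ⟨q, hq⟩
  · exact absurd (hq ▸ a.isUnit) (rt_not_unit hn1 q)
  · exact kap_surj_aux m n hn n 1 le_rfl (by omega) a q (by rw [hq, pow_one])

lemma not_sq (i : ℕ) (s : Rtrunc (2 * i + 2)) : s ^ 2 ≠ 1 + xbar (2 * i + 2) ^ (2 * i + 1) := by
  intro h
  obtain ⟨f, rfl⟩ := Ideal.Quotient.mk_surjective s
  unfold xbar at h
  rw [← map_pow, ← map_pow, ← map_one (Ideal.Quotient.mk _), ← map_add, Ideal.Quotient.eq,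
    Ideal.mem_span_singleton, Polynomial.X_pow_dvd_iff] at h
  have h1 := h (2 * i + 1) (by omega)
  rw [← ZMod.expand_card, Polynomial.coeff_sub, Polynomial.coeff_expand (by norm_num),
    if_neg (by omega), Polynomial.coeff_add, Polynomial.coeff_one, if_neg (by omega),
    Polynomial.coeff_X_pow, if_pos rfl] at h1
  exact absurd h1 (by decide)

lemma kap_inj (m n : ℕ) (hn : 2 * m ≤ n) : Function.Injective (kap m n) := by
  rw [injective_iff_map_eq_zero]
  intro v hv
  have h01 : ∀ c : ZMod 2, c ≠ 0 → c = 1 := by decide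
  suffices H : ∀ k : ℕ, ∀ hk : k < m, v ⟨k, hk⟩ = 0 by
    ext ⟨k, hk⟩; exact H k hk
  intro k
  induction k using Nat.strong_induction_on with
  | _ k ih =>
  intro hk
  by_contra hne
  have hprod : kap m n v = Additive.ofMul (cls (∏ j : Fin m, bu n j ^ (v j).val)) := by
    rw [kap, Fintype.linearCombination_apply]
    have e : cls (∏ j : Fin m, bu n j ^ (v j).val) = ∏ j : Fin m, cls (bu n j) ^ (v j).val := by
      have := map_prod (MonoidHom.mk' (cls (R := Rtrunc n)) cls_mul)
        (fun j : Fin m => bu n j ^ (v j).val) Finset.univ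
      simp only [map_pow] at this
      exact this
    rw [e, ofMul_prod]
    refine Finset.sum_congr rfl fun j _ => ?_
    rw [ofMul_pow, ← Nat.cast_smul_eq_nsmul (ZMod 2), ZMod.natCast_zmod_val]
  rw [hprod] at hv
  obtain ⟨s, hs⟩ := cls_eq_one.mp (Additive.ofMul.injective hv)
  have hle : Ideal.span {(Polynomial.X : Polynomial (ZMod 2)) ^ n} ≤
      Ideal.span {(Polynomial.X : Polynomial (ZMod 2)) ^ (2 * k + 2)} := by
    rw [Ideal.span_singleton_le_span_singleton]
    exact pow_dvd_pow _ (by omega)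
  let φ : Rtrunc n →+* Rtrunc (2 * k + 2) := Ideal.Quotient.factor hle
  have hφ : φ (xbar n) = xbar (2 * k + 2) := rfl
  have hs' := congrArg (fun u : (Rtrunc n)ˣ => φ (u : Rtrunc n)) hs
  simp only [Units.val_pow_eq_pow_val, map_pow, Units.coe_prod, map_prod, bu_val, map_add,
    map_one, hφ] at hs'
  rw [Finset.prod_eq_single (⟨k, hk⟩ : Fin m)] at hs'
  · rw [h01 _ hne] at hs'
    exact not_sq k _ (by simpa [ZMod.val_one] using hs')
  · intro j _ hj
    rcases lt_trichotomy (j : ℕ) k with h | h | h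
    · have : v j = 0 := ih j h j.2
      rw [this]; simp
    · exact absurd (Fin.ext h) hj
    · obtain ⟨t, ht⟩ : ∃ t, 2 * (j : ℕ) + 1 = 2 * k + 2 + t := ⟨2 * j + 1 - (2 * k + 2), by omega⟩
      rw [ht, pow_add _ (2 * k + 2), rt_xpow]; simp
  · simp

/-- For `m ≥ 1` and `n = 2m` or `n = 2m+1`, there is an isomorphism of
abelian groups `ℤ × (ℤ/2)^m ≅ GW(𝔽₂[x]/(xⁿ))` sending `(1, 0)` to `[1]` and the `i`-th
standard generator of `(ℤ/2)^m` to `⟨⟨1 + x^{2i+1}⟩⟩ = [1] − [1 + x^{2i+1}]`. -/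
theorem gw_trunc (m : ℕ) (hm : 1 ≤ m) (n : ℕ) (hn : n = 2 * m ∨ n = 2 * m + 1) :
    ∃ e : ℤ × (Fin m → ZMod 2) ≃+ GW (Rtrunc n),
      e (1, 0) = gw 1 ∧
      ∀ i : Fin m, ∃ u : (Rtrunc n)ˣ,
        (u : Rtrunc n) = 1 + xbar n ^ (2 * (i : ℕ) + 1) ∧
        e (0, Pi.single i 1) = gw 1 - gw u := by
  have hn1 : 1 ≤ n := by omega
  let k : (Fin m → ZMod 2) ≃+ Additive (SqCl (Rtrunc n)) :=
    AddEquiv.ofBijective (kap m n).toAddMonoidHom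
      ⟨kap_inj m n (by omega), kap_surj m n (by omega) hn1⟩
  have hk : ∀ v, k v = kap m n v := fun _ => rfl
  refine ⟨((AddEquiv.refl ℤ).prodCongr k).trans (gwEquiv hn1), ?_, fun i => ⟨bu n i, rfl, ?_⟩⟩
  · change (1 : ℤ) • (1 : GW (Rtrunc n)) + tau hn1 (k 0) = gw 1
    simp [gw_one]
  · change (0 : ℤ) • (1 : GW (Rtrunc n)) + tau hn1 (k (Pi.single i 1)) = gw 1 - gw (bu n i)
    rw [hk, kap_single, tau_cls, gw_one, zero_smul, zero_add]

end
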